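/- Fix a dominant tuple μ ∈ (ℤ_{≥0}^n)^d (each component weakly decreasing). The Hodge point of an EL-chart A is type(A)_dom. Then the assignment A ↦ cotype(A) induces a bijection from the set of normalised EL-charts with Hodge point μ onto P_μ = { μ' ∈ P_{m,n,d} : μ'_dom = μ }. -/

import Mathlib

namespace ELChart

/-- An EL-chart (for parameters `d`, `n` and `mfun τ = m_τ`): a non-empty subset
`A ⊆ ℤ^(d) = (ℤ/dℤ) × ℤ` which is bounded below and satisfies `f(A) ⊆ A` and `A + n ⊆ A`,
where `f (τ, x) = (τ + 1, x + m_τ)`. -/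
def IsChart (d n : ℕ) (mfun : ZMod d → ℤ) (A : Set (ZMod d × ℤ)) : Prop :=
  A.Nonempty ∧ (∃ c : ℤ, ∀ p ∈ A, c ≤ p.2) ∧
    (∀ p ∈ A, ((p.1 + 1 : ZMod d), p.2 + mfun p.1) ∈ A) ∧
    (∀ p ∈ A, (p.1, p.2 + (n : ℤ)) ∈ A)

/-- `B = A ∖ (A + n)`. -/
def Bset (d n : ℕ) (A : Set (ZMod d × ℤ)) : Set (ZMod d × ℤ) :=
  {p | p ∈ A ∧ (p.1, p.2 - (n : ℤ)) ∉ A}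

/-- The shift `A + z` of a subset of `ℤ^(d)`. -/
def shift (d : ℕ) (A : Set (ZMod d × ℤ)) (z : ℤ) : Set (ZMod d × ℤ) :=
  (fun p : ZMod d × ℤ => (p.1, p.2 + z)) '' A

/-- Two EL-charts are equivalent if they differ by a shift. -/
def ChartEquiv (d : ℕ) (A A' : Set (ZMod d × ℤ)) : Prop :=
  ∃ z : ℤ, shift d A z = A'

/-- The sequence `b 0, b 1, …` associated with an EL-chart: `b 0 = min B_(0)` and `b (i+1)`
is the unique element of `B` of the form `f (b i) − c * n` with `c` a non-negative integer. -/
noncomputable def bseq (d n : ℕ) (mfun : ZMod d → ℤ) (A : Set (ZMod d × ℤ)) :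
    ℕ → ZMod d × ℤ
  | 0 => ((0 : ZMod d), sInf {x : ℤ | ((0 : ZMod d), x) ∈ Bset d n A})
  | i + 1 =>
    ((bseq d n mfun A i).1 + 1,
      sInf {y : ℤ | ((bseq d n mfun A i).1 + 1, y) ∈ Bset d n A ∧
        ((bseq d n mfun A i).2 + mfun (bseq d n mfun A i).1 - y) % (n : ℤ) = 0 ∧
        y ≤ (bseq d n mfun A i).2 + mfun (bseq d n mfun A i).1})

/-- The entry `μ'_k` (for `1 ≤ k ≤ d*n`) of the type of an EL-chart: the non-negative integer
with `b k = f (b (k-1)) − μ'_k * n`. -/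
noncomputable def typeInt (d n : ℕ) (mfun : ZMod d → ℤ) (A : Set (ZMod d × ℤ)) (k : ℕ) : ℤ :=
  ((bseq d n mfun A (k - 1)).2 + mfun (bseq d n mfun A (k - 1)).1
    - (bseq d n mfun A k).2) / (n : ℤ)

/-- The type of an EL-chart as a tuple: `μ'_{τ,i} = μ'_{τ + (i−1)d}` where the `Fin d`-index
`τ` corresponds to `τ + 1 ∈ {1, …, d}` and the `Fin n`-index `i` to `i + 1 ∈ {1, …, n}`. -/
noncomputable def typeTup (d n : ℕ) (mfun : ZMod d → ℤ) (A : Set (ZMod d × ℤ)) :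
    Fin d → Fin n → ℤ :=
  fun τ i => typeInt d n mfun A (τ.val + 1 + i.val * d)

/-- The entry `μ'_{τ',i'}` of the type of an EL-chart attached to an element `p = b_{τ',i'}`
of `B`: if `q ∈ B` is the (unique) predecessor of `p`, i.e. the element with
`p = f q − c * n` for a non-negative integer `c`, then `muOf p = c`. -/
noncomputable def muOf (d n : ℕ) (mfun : ZMod d → ℤ) (A : Set (ZMod d × ℤ))
    (p : ZMod d × ℤ) : ℤ :=
  (sInf {y : ℤ | ((p.1 - 1 : ZMod d), y) ∈ Bset d n A ∧
      (y + mfun (p.1 - 1) - p.2) % (n : ℤ) = 0 ∧ p.2 ≤ y + mfun (p.1 - 1)}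
    + mfun (p.1 - 1) - p.2) / (n : ℤ)

/-- The `i`-th largest element `b̃_{τ,i}` of `B_(τ)` (1-indexed: `i ∈ {1, …, n}`): the unique
element of `B_(τ)` with exactly `i − 1` elements of `B_(τ)` above it. -/
noncomputable def btilde (d n : ℕ) (A : Set (ZMod d × ℤ)) (τ : ZMod d) (i : ℕ) : ℤ :=
  sInf {y : ℤ | (τ, y) ∈ Bset d n A ∧
    Set.ncard {z : ℤ | (τ, z) ∈ Bset d n A ∧ y < z} = i - 1}

/-- The cotype of an EL-chart as a tuple: `μ̃_{τ,i} = μ'_{τ',i'}` where `b̃_{τ,i} = b_{τ',i'}`,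
i.e. the type entry attached to the `i`-th largest element of `B_(τ)`. -/
noncomputable def cotypeTup (d n : ℕ) (mfun : ZMod d → ℤ) (A : Set (ZMod d × ℤ)) :
    Fin d → Fin n → ℤ :=
  fun τ i =>
    muOf d n mfun A (((τ.val + 1 : ℕ) : ZMod d),
      btilde d n A ((τ.val + 1 : ℕ) : ZMod d) (i.val + 1))

/-- Membership in `P_{m,n,d}`: all entries are non-negative and
`Σ_{i=1}^k Σ_{τ=1}^d μ_{τ,i} ≤ k*m/n` for `k = 1, …, n`, with equality for `k = n`. -/
def memP (d n m : ℕ) (μ : Fin d → Fin n → ℤ) : Prop :=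
  (∀ τ i, 0 ≤ μ τ i) ∧
    (∀ k : ℕ, 1 ≤ k → k ≤ n →
      (n : ℤ) * ∑ τ : Fin d, ∑ i : Fin n, (if i.val + 1 ≤ k then μ τ i else 0)
        ≤ (k : ℤ) * (m : ℤ)) ∧
    (∑ τ : Fin d, ∑ i : Fin n, μ τ i) = (m : ℤ)

/-- An EL-chart is normalised if `Σ_{b ∈ B_(0)} |b| = n(n−1)/2`. -/
def IsNormalised (d n : ℕ) (A : Set (ZMod d × ℤ)) : Prop :=
  ∑ᶠ x ∈ {x : ℤ | ((0 : ZMod d), x) ∈ Bset d n A}, x = ((n * (n - 1) / 2 : ℕ) : ℤ)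

/-- The dominant rearrangement of a tuple: each component is sorted weakly decreasingly. -/
def domOf (d n : ℕ) (μ : Fin d → Fin n → ℤ) : Fin d → Fin n → ℤ :=
  fun τ i => μ τ (Tuple.sort (fun j => -(μ τ j)) i)

/-- A tuple is dominant if each of its `d` components is weakly decreasing. -/
def IsDom (d n : ℕ) (μ : Fin d → Fin n → ℤ) : Prop :=
  ∀ τ : Fin d, ∀ i j : Fin n, i ≤ j → μ τ j ≤ μ τ i

end ELChart

namespace ELChart

theorem sum_sq_sub_perm_eq {n : ℕ} (a b : Fin n → ℤ) (s r : Equiv.Perm (Fin n)) :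
    ∑ i, (a (s i) - b (r i)) ^ 2 = ∑ i, (a i - b i) ^ 2
      + 2 * (∑ i, a i * b i - ∑ i, a i * b ((s⁻¹.trans r) i)) := by
  have h1 : ∑ i, (a (s i) - b (r i)) ^ 2 = ∑ i, a i ^ 2 + ∑ i, b i ^ 2
      - 2 * ∑ i, a i * b ((s⁻¹.trans r) i) := by
    rw [← Equiv.sum_comp s (fun i => a i ^ 2), ← Equiv.sum_comp r (fun i => b i ^ 2),
      ← Equiv.sum_comp s (fun i => a i * b ((s⁻¹.trans r) i)), Finset.mul_sum,
      ← Finset.sum_add_distrib, ← Finset.sum_sub_distrib]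
    refine Finset.sum_congr rfl fun i _ => ?_
    simp
    ring
  have h2 : ∑ i, (a i - b i) ^ 2 = ∑ i, a i ^ 2 + ∑ i, b i ^ 2 - 2 * ∑ i, a i * b i := by
    rw [Finset.mul_sum, ← Finset.sum_add_distrib, ← Finset.sum_sub_distrib]
    exact Finset.sum_congr rfl fun i _ => by ring
  linarith

/-- Sorting is nonexpansive for the Euclidean distance. -/
theorem sum_sq_sub_le_of_antitone {n : ℕ} {a b : Fin n → ℤ} (ha : Antitone a) (hb : Antitone b)
    (s r : Equiv.Perm (Fin n)) :
    ∑ i, (a i - b i) ^ 2 ≤ ∑ i, (a (s i) - b (r i)) ^ 2 := by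
  have := (ha.monovary hb).sum_mul_comp_perm_le_sum_mul (σ := s⁻¹.trans r)
  have := sum_sq_sub_perm_eq a b s r
  linarith

/-- Equality in `sum_sq_sub_le_of_antitone` forces the two permutations to agree, provided that
the sorted sequences have no repetitions. -/
theorem perm_eq_of_sum_sq_sub_le {n : ℕ} {a b : Fin n → ℤ} (ha : StrictAnti a)
    (hb : StrictAnti b) {s r : Equiv.Perm (Fin n)}
    (h : ∑ i, (a (s i) - b (r i)) ^ 2 ≤ ∑ i, (a i - b i) ^ 2) : s = r := by
  have key := sum_sq_sub_perm_eq a b s r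
  have hab := ha.antitone.monovary hb.antitone
  have hle := hab.sum_mul_comp_perm_le_sum_mul (σ := s⁻¹.trans r)
  have hmono := hab.sum_mul_comp_perm_eq_sum_mul_iff.1 (le_antisymm hle (by linarith))
  have h1 : s⁻¹.trans r = 1 := by
    rw [← Equiv.Perm.monotone_iff]
    intro i j hij
    by_contra hlt
    rw [not_le] at hlt
    have := ha.le_iff_ge.1 (hmono (show (b ∘ (s⁻¹.trans r)) i < _ from hb hlt))
    obtain rfl := le_antisymm hij this
    exact lt_irrefl _ hlt
  ext i
  have := congrArg (fun e => e (s i)) h1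
  simp at this
  simp [this]

/-- `y` arises from the family `x` by adding the increments `c`, moving the component with
index `τ` to index `τ - 1` and sorting it decreasingly by means of the permutations `s`. -/
structure IsSortStep {d n : ℕ} (c : ZMod d → Fin n → ℤ) (s : ZMod d → Equiv.Perm (Fin n))
    (x y : ZMod d → Fin n → ℤ) : Prop where
  strictAnti : ∀ τ, StrictAnti (y τ)
  apply_eq : ∀ τ i, y (τ - 1) (s τ i) = x τ i + c τ i

/-- The squared Euclidean distance of two families. -/
def sqDist {d n : ℕ} [NeZero d] (x y : ZMod d → Fin n → ℤ) : ℤ :=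
  ∑ τ, ∑ i, (x τ i - y τ i) ^ 2

section Dynamics

variable {d n : ℕ} [NeZero d] {c : ZMod d → Fin n → ℤ}

theorem sum_pred {M : Type*} [AddCommMonoid M] (F : ZMod d → M) :
    ∑ τ, F (τ - 1) = ∑ τ, F τ :=
  Equiv.sum_comp (Equiv.subRight (1 : ZMod d)) F

theorem IsSortStep.sqDist_eq {s r : ZMod d → Equiv.Perm (Fin n)}
    {x y x' y' : ZMod d → Fin n → ℤ} (hx : IsSortStep c s x x') (hy : IsSortStep c r y y') :
    sqDist x y = ∑ τ, ∑ i, (x' (τ - 1) (s τ i) - y' (τ - 1) (r τ i)) ^ 2 := by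
  simp only [sqDist, hx.apply_eq, hy.apply_eq, add_sub_add_right_eq_sub]

theorem IsSortStep.sqDist_le {s r : ZMod d → Equiv.Perm (Fin n)}
    {x y x' y' : ZMod d → Fin n → ℤ} (hx : IsSortStep c s x x') (hy : IsSortStep c r y y') :
    sqDist x' y' ≤ sqDist x y := by
  rw [hx.sqDist_eq hy, sqDist, ← sum_pred]
  exact Finset.sum_le_sum fun τ _ => sum_sq_sub_le_of_antitone
    (hx.strictAnti _).antitone (hy.strictAnti _).antitone _ _

theorem IsSortStep.perm_eq {s r : ZMod d → Equiv.Perm (Fin n)}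
    {x y x' y' : ZMod d → Fin n → ℤ} (hx : IsSortStep c s x x') (hy : IsSortStep c r y y')
    (h : sqDist x y ≤ sqDist x' y') : s = r := by
  have heq := le_antisymm (hx.sqDist_le hy) h
  rw [hx.sqDist_eq hy, sqDist, ← sum_pred, Finset.sum_eq_sum_iff_of_le] at heq
  · funext τ
    exact perm_eq_of_sum_sq_sub_le (hx.strictAnti _) (hy.strictAnti _)
      (heq τ (Finset.mem_univ _)).ge
  · exact fun τ _ => sum_sq_sub_le_of_antitone
      (hx.strictAnti _).antitone (hy.strictAnti _).antitone _ _

/-- The permutation of `ℤ/d × {1, …, n}` lying over `τ ↦ τ - 1` given by a family of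
permutations of the fibres. -/
def stepPerm (s : ZMod d → Equiv.Perm (Fin n)) : Equiv.Perm (ZMod d × Fin n) where
  toFun q := (q.1 - 1, s q.1 q.2)
  invFun q := (q.1 + 1, (s (q.1 + 1)).symm q.2)
  left_inv q := by simp
  right_inv q := by simp

omit [NeZero d] in
theorem stepPerm_iterate_fst (s : ZMod d → Equiv.Perm (Fin n)) (t : ℕ) (q : ZMod d × Fin n) :
    ((stepPerm s)^[t] q).1 = q.1 - t := by
  induction t with
  | zero => simp
  | succ t ih =>
    rw [Function.iterate_succ_apply']
    simp only [stepPerm, Equiv.coe_fn_mk] at ih ⊢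
    rw [ih]
    push_cast
    ring

omit [NeZero d] in
theorem iterate_apply_eq_add_sum {s : ZMod d → Equiv.Perm (Fin n)} {x : ℕ → ZMod d → Fin n → ℤ}
    (h : ∀ j τ i, x (j + 1) (τ - 1) (s τ i) = x j τ i + c τ i) (j t : ℕ) (q : ZMod d × Fin n) :
    Function.uncurry (x (j + t)) ((stepPerm s)^[t] q) = Function.uncurry (x j) q
      + ∑ k ∈ Finset.range t, Function.uncurry c ((stepPerm s)^[k] q) := by
  induction t with
  | zero => simp
  | succ t ih =>
    rw [Finset.sum_range_succ, ← add_assoc (Function.uncurry (x j) q), ← ih, Function.iterate_succ_apply']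
    exact h _ _ _

end Dynamics

section Transitivity

variable {d n m : ℕ} [NeZero d] {mfun : ZMod d → ℤ}

theorem sum_range_mul_mfun (hsum : ∑ τ : ZMod d, mfun τ = (m : ℤ)) (τ : ZMod d) (l : ℕ) :
    ∑ j ∈ Finset.range (d * l), mfun (τ - j - 1) = l * m := by
  induction l with
  | zero => simp
  | succ l ih =>
    rw [Nat.mul_succ, Finset.sum_range_add, ih]
    have : ∑ j ∈ Finset.range d, mfun (τ - ((d * l + j : ℕ) : ZMod d) - 1) = m := by
      rw [← hsum, Finset.sum_range]
      refine Fintype.sum_bijective (fun j : Fin d => τ - ((d * l + j.val : ℕ) : ZMod d) - 1) ?_ _ _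
        fun _ => rfl
      rw [Fintype.bijective_iff_injective_and_card]
      refine ⟨fun a b hab => ?_, by simp [ZMod.card]⟩
      simp only [Nat.cast_add, Nat.cast_mul, CharP.cast_eq_zero, zero_mul, zero_add, sub_left_inj,
        sub_right_inj] at hab
      rw [ZMod.natCast_eq_natCast_iff'] at hab
      rw [Nat.mod_eq_of_lt a.2, Nat.mod_eq_of_lt b.2] at hab
      exact Fin.ext hab
    rw [this]
    push_cast
    ring

variable {s : ZMod d → Equiv.Perm (Fin n)} {ν x : ZMod d → Fin n → ℤ} {N : ℤ}

theorem exists_iterate_apply_eq (hsum : ∑ τ : ZMod d, mfun τ = (m : ℤ))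
    (hx : ∀ τ i, x (τ - 1) (s τ i) = x τ i + N * (n * ν τ i - mfun (τ - 1)))
    (l : ℕ) (q : ZMod d × Fin n) :
    ∃ M : ℤ, Function.uncurry x ((stepPerm s)^[d * l] q) =
      Function.uncurry x q + N * (n * M - l * m) := by
  refine ⟨∑ k ∈ Finset.range (d * l), Function.uncurry ν ((stepPerm s)^[k] q), ?_⟩
  have := iterate_apply_eq_add_sum (x := fun _ => x)
    (c := fun τ i => N * (n * ν τ i - mfun (τ - 1))) (fun _ => hx) 0 (d * l) q
  rw [this, ← sum_range_mul_mfun hsum q.1 l, Finset.mul_sum, ← Finset.sum_sub_distrib,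
    Finset.mul_sum]
  congr 1
  refine Finset.sum_congr rfl fun k _ => ?_
  rw [← stepPerm_iterate_fst s k q]
  rfl

theorem mul_dvd_of_iterate_eq (hmn : Nat.Coprime m n)
    (hsum : ∑ τ : ZMod d, mfun τ = (m : ℤ)) (hN : N ≠ 0)
    (hx : ∀ τ i, x (τ - 1) (s τ i) = x τ i + N * (n * ν τ i - mfun (τ - 1)))
    {t : ℕ} {q : ZMod d × Fin n} (h : (stepPerm s)^[t] q = q) : d * n ∣ t := by
  have h1 := stepPerm_iterate_fst s t q
  rw [h, eq_comm, sub_eq_self, ZMod.natCast_eq_zero_iff] at h1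
  obtain ⟨l, rfl⟩ := h1
  obtain ⟨M, hM⟩ := exists_iterate_apply_eq hsum hx l q
  rw [h, left_eq_add, mul_eq_zero, or_iff_right hN, sub_eq_zero] at hM
  have : n ∣ l * m := by
    zify
    exact ⟨M, hM.symm⟩
  exact mul_dvd_mul_left d (hmn.symm.dvd_of_dvd_mul_right this)

theorem exists_iterate_eq (hmn : Nat.Coprime m n)
    (hsum : ∑ τ : ZMod d, mfun τ = (m : ℤ)) (hN : N ≠ 0)
    (hx : ∀ τ i, x (τ - 1) (s τ i) = x τ i + N * (n * ν τ i - mfun (τ - 1)))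
    (q q' : ZMod d × Fin n) : ∃ t < d * n, (stepPerm s)^[t] q = q' := by
  have hinj : Function.Injective (fun t : Fin (d * n) => (stepPerm s)^[t.val] q) := by
    have aux : ∀ a b : Fin (d * n), a.val < b.val →
        (stepPerm s)^[a.val] q ≠ (stepPerm s)^[b.val] q := by
      intro a b hab heq
      have h2 : b.val = a.val + (b.val - a.val) := by omega
      rw [h2, Function.iterate_add_apply] at heq
      have h3 := ((stepPerm s).injective.iterate a.val) heq
      have h4 := Nat.le_of_dvd (by omega) (mul_dvd_of_iterate_eq hmn hsum hN hx h3.symm)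
      have := b.2
      omega
    intro a b hab
    rcases lt_trichotomy a.val b.val with h | h | h
    · exact absurd hab (aux a b h)
    · exact Fin.ext h
    · exact absurd hab.symm (aux b a h)
  have hbij := (Fintype.bijective_iff_injective_and_card _).2 ⟨hinj, by simp [ZMod.card]⟩
  obtain ⟨t, ht⟩ := hbij.2 q'
  exact ⟨t, t.2, ht⟩

/-- A function on the index set that is invariant under the step permutation is constant. -/
theorem eq_of_invariant (hmn : Nat.Coprime m n)
    (hsum : ∑ τ : ZMod d, mfun τ = (m : ℤ)) (hN : N ≠ 0)
    (hx : ∀ τ i, x (τ - 1) (s τ i) = x τ i + N * (n * ν τ i - mfun (τ - 1)))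
    {M : Type*} {g : ZMod d → Fin n → M} (hg : ∀ τ i, g (τ - 1) (s τ i) = g τ i)
    (τ τ' : ZMod d) (i i' : Fin n) : g τ i = g τ' i' := by
  obtain ⟨t, -, ht⟩ := exists_iterate_eq hmn hsum hN hx (τ, i) (τ', i')
  have key : ∀ t q, Function.uncurry g ((stepPerm s)^[t] q) = Function.uncurry g q := by
    intro t q
    induction t with
    | zero => rfl
    | succ t ih =>
      rw [Function.iterate_succ_apply', ← ih]
      exact hg _ _
  have := key t (τ, i)
  rw [ht] at this
  exact this.symm

/-- The components of a fixed family have pairwise incongruent entries modulo `n`. -/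
theorem eq_of_dvd_sub (hmn : Nat.Coprime m n)
    (hsum : ∑ τ : ZMod d, mfun τ = (m : ℤ))
    (hx : ∀ τ i, x (τ - 1) (s τ i) = x τ i + (n * ν τ i - mfun (τ - 1)))
    {τ : ZMod d} {i j : Fin n} (h : (n : ℤ) ∣ x τ i - x τ j) : i = j := by
  have hx' : ∀ τ i, x (τ - 1) (s τ i) = x τ i + 1 * (n * ν τ i - mfun (τ - 1)) := by
    simpa using hx
  obtain ⟨t, htlt, ht⟩ := exists_iterate_eq hmn hsum one_ne_zero hx' (τ, i) (τ, j)
  have h1 := stepPerm_iterate_fst s t (τ, i)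
  rw [ht, eq_comm, sub_eq_self, ZMod.natCast_eq_zero_iff] at h1
  obtain ⟨l, rfl⟩ := h1
  obtain ⟨M, hM⟩ := exists_iterate_apply_eq hsum hx' l (τ, i)
  rw [ht] at hM
  simp only [Function.uncurry_apply_pair] at hM
  have h2 : n ∣ l * m := by
    zify
    have : (l * m : ℤ) = n * M + (x τ i - x τ j) := by linarith
    rw [this]
    exact dvd_add (dvd_mul_right _ _) h
  have h3 := hmn.symm.dvd_of_dvd_mul_right h2
  have h4 : l < n := lt_of_mul_lt_mul_left htlt (Nat.zero_le d)
  obtain rfl := Nat.eq_zero_of_dvd_of_lt h3 h4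
  simpa using ht

end Transitivity

section Existence

variable {d n m : ℕ} [NeZero d] {mfun : ZMod d → ℤ}

/-- In each component the entries are pairwise incongruent modulo `n`. -/
def IsIncongruent {d n : ℕ} (x : ZMod d → Fin n → ℤ) : Prop :=
  ∀ τ i j, (n : ℤ) ∣ x τ i - x τ j → i = j

/-- The increments occurring in a chart with cotype `ν`. -/
def increment {d n : ℕ} (mfun : ZMod d → ℤ) (ν : ZMod d → Fin n → ℤ) : ZMod d → Fin n → ℤ :=
  fun τ i => n * ν τ i - mfun (τ - 1)

omit [NeZero d] in
theorem exists_isSortStep (ν : ZMod d → Fin n → ℤ) {x : ZMod d → Fin n → ℤ}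
    (hx : IsIncongruent x) :
    ∃ s y, IsSortStep (increment mfun ν) s x y ∧ IsIncongruent y := by
  let v : ZMod d → Fin n → ℤ := fun τ i => x τ i + increment mfun ν τ i
  have hv : IsIncongruent v := by
    intro τ i j h
    apply hx τ
    have : x τ i - x τ j = v τ i - v τ j - n * (ν τ i - ν τ j) := by
      simp only [v, increment]
      ring
    rw [this]
    exact dvd_sub h (dvd_mul_right _ _)
  let s : ZMod d → Equiv.Perm (Fin n) := fun τ => (Tuple.sort (fun i => -v τ i)).symm
  refine ⟨s, fun τ i => v (τ + 1) ((s (τ + 1)).symm i), ⟨fun τ => ?_, fun τ i => ?_⟩, ?_⟩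
  · refine Antitone.strictAnti_of_injective (fun i j hij => ?_) fun i j hij => ?_
    · have := Tuple.monotone_sort (fun i => -v (τ + 1) i) hij
      simpa [s] using this
    · exact (s (τ + 1)).symm.injective (hv (τ + 1) _ _ (by simp [hij]))
  · simp [v]
  · intro τ i j h
    exact (s (τ + 1)).symm.injective (hv (τ + 1) _ _ h)

/-- A trajectory of the sorting dynamics along which the sorting permutations do not change. -/
theorem exists_trajectory (ν : ZMod d → Fin n → ℤ) :
    ∃ (s : ZMod d → Equiv.Perm (Fin n)) (x : ℕ → ZMod d → Fin n → ℤ),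
      ∀ j, IsSortStep (increment mfun ν) s (x j) (x (j + 1)) := by
  have hstep : ∀ x : {x : ZMod d → Fin n → ℤ // IsIncongruent x},
      ∃ (s : ZMod d → Equiv.Perm (Fin n)) (y : {x : ZMod d → Fin n → ℤ // IsIncongruent x}),
        IsSortStep (increment mfun ν) s x.1 y.1 := fun x =>
    let ⟨s, y, h, hy⟩ := exists_isSortStep ν x.2
    ⟨s, ⟨y, hy⟩, h⟩
  choose F G hFG using hstep
  have hne : IsIncongruent (fun (_ : ZMod d) (i : Fin n) => (i.val : ℤ)) := by
    intro τ i j h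
    have h1 := i.2
    have h2 := j.2
    beta_reduce at h
    have := Int.eq_zero_of_abs_lt_dvd h (by rw [abs_lt]; omega)
    exact Fin.ext (by omega)
  let E : {x : ZMod d → Fin n → ℤ // IsIncongruent x} → ℕ := fun x => (sqDist x.1 (G x).1).toNat
  have hnonneg : ∀ x y : ZMod d → Fin n → ℤ, 0 ≤ sqDist x y := fun x y =>
    Finset.sum_nonneg fun _ _ => Finset.sum_nonneg fun _ _ => sq_nonneg _
  obtain ⟨x₀, -, hmin⟩ := WellFounded.has_min (measure E).wf Set.univ ⟨⟨_, hne⟩, trivial⟩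
  have hmin' : ∀ x, sqDist x₀.1 (G x₀).1 ≤ sqDist x.1 (G x).1 := by
    intro x
    have h1 : ¬ E x < E x₀ := hmin x trivial
    have h2 := hnonneg x.1 (G x).1
    simp only [E] at h1
    omega
  have hle : ∀ j, sqDist (G^[j] x₀).1 (G (G^[j] x₀)).1 ≤ sqDist x₀.1 (G x₀).1 := by
    intro j
    induction j with
    | zero => rfl
    | succ j ih =>
      rw [Function.iterate_succ_apply']
      exact ((hFG _).sqDist_le (hFG _)).trans ih
  have hF : ∀ j, F (G^[j] x₀) = F x₀ := by
    intro j
    induction j with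
    | zero => rfl
    | succ j ih =>
      rw [← ih, Function.iterate_succ_apply']
      exact ((hFG _).perm_eq (hFG _) ((hle j).trans (hmin' _))).symm
  refine ⟨F x₀, fun j => (G^[j] x₀).1, fun j => ?_⟩
  rw [← hF j]
  simpa only [Function.iterate_succ_apply'] using hFG _

theorem card_filter_eq_of_invariant {s : ZMod d → Equiv.Perm (Fin n)}
    {D : ZMod d → Fin n → ℤ} (hD : ∀ τ i, D (τ - 1) (s τ i) = D τ i) (v : ℤ) (τ : ZMod d) :
    Fintype.card {i // v ≤ D τ i} = Fintype.card {i // v ≤ D 0 i} := by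
  have h1 : ∀ τ, Fintype.card {i // v ≤ D (τ - 1) i} = Fintype.card {i // v ≤ D τ i} := fun τ =>
    Fintype.card_congr ((s τ).subtypeEquiv fun i => by rw [hD]).symm
  have h2 : ∀ t : ℕ, Fintype.card {i // v ≤ D (τ - t) i} = Fintype.card {i // v ≤ D τ i} := by
    intro t
    induction t with
    | zero => simp
    | succ t ih =>
      rw [← ih, ← h1 (τ - t), Nat.cast_succ, sub_sub]
  rw [← h2 τ.val]
  simp

theorem sum_mul_iterate_eq {I : Type*} [Fintype I] (σ : Equiv.Perm I) {w : I → ℤ}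
    (hw : ∀ q, w (σ q) = w q) (c : I → ℤ) (N : ℕ) :
    ∑ q, w q * ∑ k ∈ Finset.range N, c (σ^[k] q) = N * ∑ q, w q * c q := by
  have hw' : ∀ k q, w (σ^[k] q) = w q := by
    intro k q
    induction k with
    | zero => rfl
    | succ k ih => rw [Function.iterate_succ_apply', hw, ih]
  simp_rw [Finset.mul_sum]
  rw [Finset.sum_comm]
  have : ∀ k ∈ Finset.range N, ∑ q, w q * c (σ^[k] q) = ∑ q, w q * c q := by
    intro k _
    rw [← Equiv.sum_comp (σ ^ k) (fun q => w q * c q)]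
    refine Finset.sum_congr rfl fun q _ => ?_
    rw [← Equiv.Perm.iterate_eq_pow, hw']
  rw [Finset.sum_congr rfl this]
  simp [Finset.mul_sum]

theorem sum_increment (hsum : ∑ τ : ZMod d, mfun τ = (m : ℤ)) (ν : ZMod d → Fin n → ℤ) {k : ℕ}
    (hk : k ≤ n) :
    ∑ q : ZMod d × Fin n, (if q.2.val < k then 1 else 0) * Function.uncurry (increment mfun ν) q =
      n * ∑ τ : ZMod d, ∑ i : Fin n, (if i.val < k then ν τ i else 0) - k * m := by
  rw [Fintype.sum_prod_type, Finset.mul_sum, ← hsum, ← sum_pred mfun, Finset.mul_sum,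
    ← Finset.sum_sub_distrib]
  refine Finset.sum_congr rfl fun τ _ => ?_
  have hcard : ∑ i : Fin n, (if i.val < k then mfun (τ - 1) else 0) = k * mfun (τ - 1) := by
    rw [← Finset.sum_filter, Finset.sum_const, Fin.card_filter_val_lt, min_eq_right hk, nsmul_eq_mul]
  rw [← hcard, Finset.mul_sum, ← Finset.sum_sub_distrib]
  refine Finset.sum_congr rfl fun i _ => ?_
  by_cases h : i.val < k <;> simp [h, increment]

/-- Along a trajectory with constant sorting permutations the drift after one period vanishes. -/
theorem drift_eq_zero (hsum : ∑ τ : ZMod d, mfun τ = (m : ℤ)) {ν : ZMod d → Fin n → ℤ}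
    (hP : ∀ k ≤ n, n * ∑ τ : ZMod d, ∑ i : Fin n, (if i.val < k then ν τ i else 0) ≤ k * (m : ℤ))
    (htot : ∑ τ : ZMod d, ∑ i : Fin n, ν τ i = m) {s : ZMod d → Equiv.Perm (Fin n)}
    {D : ZMod d → Fin n → ℤ} (hanti : ∀ τ, Antitone (D τ))
    (hinv : ∀ τ i, D (τ - 1) (s τ i) = D τ i) {N : ℕ}
    (hD : ∀ q, Function.uncurry D q =
      ∑ k ∈ Finset.range N, Function.uncurry (increment mfun ν) ((stepPerm s)^[k] q)) (τ i) :
    D τ i = 0 := by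
  have hseg : ∀ τ (i : Fin n), i.val < Fintype.card {i // 1 ≤ D 0 i} ↔ 1 ≤ D τ i := by
    intro τ i
    rw [← card_filter_eq_of_invariant hinv 1 τ, Fintype.card_subtype]
    exact Tuple.lt_card_ge_iff_apply_ge_of_antitone (hanti τ)
  set k := Fintype.card {i // 1 ≤ D 0 i} with hk
  have hkn : k ≤ n := (Fintype.card_subtype_le _).trans_eq (Fintype.card_fin n)
  have hsumD : ∑ q : ZMod d × Fin n, (if q.2.val < k then 1 else 0) * Function.uncurry D q ≤ 0 := by
    simp_rw [hD]
    rw [sum_mul_iterate_eq (stepPerm s) (fun q => ?_), sum_increment hsum ν hkn]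
    · exact mul_nonpos_of_nonneg_of_nonpos (Nat.cast_nonneg N) (by linarith [hP k hkn])
    · have : (s q.1 q.2).val < k ↔ q.2.val < k := by
        rw [hseg (q.1 - 1), hseg q.1, hinv]
      simp [stepPerm, this]
  have hle : ∀ q : ZMod d × Fin n, Function.uncurry D q ≤ 0 := by
    have hterm : ∀ q ∈ (Finset.univ : Finset (ZMod d × Fin n)),
        0 ≤ (if q.2.val < k then 1 else 0) * Function.uncurry D q := by
      intro q _
      by_cases h : q.2.val < k
      · have := (hseg q.1 q.2).1 h
        simp only [h, if_true, one_mul]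
        exact le_trans zero_le_one this
      · simp [h]
    intro q
    by_contra hlt
    have h1 : 1 ≤ D q.1 q.2 := not_le.1 hlt
    have h2 := (Finset.single_le_sum hterm (Finset.mem_univ q)).trans hsumD
    simp only [(hseg q.1 q.2).2 h1, if_true, one_mul] at h2
    exact hlt h2
  have htotD : ∑ q : ZMod d × Fin n, Function.uncurry D q = 0 := by
    have h1 := sum_mul_iterate_eq (stepPerm s) (w := fun _ => 1) (fun _ => rfl)
      (Function.uncurry (increment mfun ν)) N
    have h2 := sum_increment hsum ν le_rfl
    simp only [Fin.is_lt, if_true, htot] at h2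
    simp only [one_mul] at h1 h2
    simp_rw [hD]
    rw [h1, h2, sub_self, mul_zero]
  exact (Finset.sum_eq_zero_iff_of_nonpos fun q _ => hle q).1 htotD (τ, i) (Finset.mem_univ _)

/-- Every tuple in `P_{m,n,d}` is realised by a fixed family of the sorting dynamics. -/
theorem exists_fixed (hn : 0 < n) (hmn : Nat.Coprime m n)
    (hsum : ∑ τ : ZMod d, mfun τ = (m : ℤ)) {ν : ZMod d → Fin n → ℤ}
    (hP : ∀ k ≤ n, n * ∑ τ : ZMod d, ∑ i : Fin n, (if i.val < k then ν τ i else 0) ≤ k * (m : ℤ))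
    (htot : ∑ τ : ZMod d, ∑ i : Fin n, ν τ i = m) :
    ∃ s z, IsSortStep (increment mfun ν) s z z := by
  obtain ⟨s, x, hx⟩ := exists_trajectory (mfun := mfun) ν
  set N := orderOf (stepPerm s) with hN
  have hNpos : 0 < N := orderOf_pos _
  have hper : ∀ q, (stepPerm s)^[N] q = q := fun q => by
    rw [Equiv.Perm.iterate_eq_pow, pow_orderOf_eq_one, Equiv.Perm.one_apply]
  let D : ZMod d → Fin n → ℤ := fun τ i =>
    ∑ k ∈ Finset.range N, Function.uncurry (increment mfun ν) ((stepPerm s)^[k] (τ, i))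
  have hshift : ∀ j τ i, x (j + N) τ i = x j τ i + D τ i := by
    intro j τ i
    have := iterate_apply_eq_add_sum (fun j => (hx j).apply_eq) j N (τ, i)
    rwa [hper] at this
  have hinv : ∀ τ i, D (τ - 1) (s τ i) = D τ i := by
    intro τ i
    have h1 := hshift 1 (τ - 1) (s τ i)
    rw [add_comm 1 N, (hx N).apply_eq, ← zero_add 1, (hx 0).apply_eq] at h1
    have h2 := hshift 0 τ i
    rw [zero_add] at h2
    linarith
  have hmul : ∀ (a : ℕ) τ i, x (a * N + 1) τ i = x 1 τ i + a * D τ i := by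
    intro a τ i
    induction a with
    | zero => simp
    | succ a ih =>
      rw [show (a + 1) * N + 1 = a * N + 1 + N by ring, hshift, ih]
      push_cast
      ring
  have hanti : ∀ τ, Antitone (D τ) := by
    intro τ i j hij
    rcases hij.eq_or_lt with rfl | hij
    · exact le_rfl
    by_contra! hlt
    have h1 := (hx (((x 1 τ i - x 1 τ j).toNat) * N)).strictAnti τ hij
    rw [hmul, hmul] at h1
    have h2 := Int.self_le_toNat (x 1 τ i - x 1 τ j)
    nlinarith
  have hD := drift_eq_zero hsum hP htot hanti hinv (fun _ => rfl)
  let y : ZMod d → Fin n → ℤ := fun τ i => ∑ j ∈ Finset.range N, x (j + 1) τ i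
  have hy : ∀ τ i, y (τ - 1) (s τ i) = y τ i + N * (n * ν τ i - mfun (τ - 1)) := by
    intro τ i
    have h1 : y τ i + N * (n * ν τ i - mfun (τ - 1)) =
        ∑ j ∈ Finset.range N, x (j + 1 + 1) (τ - 1) (s τ i) := by
      simp only [(hx _).apply_eq, Finset.sum_add_distrib, Finset.sum_const, Finset.card_range,
        nsmul_eq_mul]
      rfl
    have h2 := Finset.sum_range_succ (fun j => x (j + 1) (τ - 1) (s τ i)) N
    rw [Finset.sum_range_succ', add_comm N 1, hshift, hD, add_zero, zero_add] at h2
    rw [h1]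
    exact (add_right_cancel h2).symm
  have hyanti : ∀ τ, StrictAnti (y τ) := fun τ i j hij =>
    Finset.sum_lt_sum_of_nonempty ⟨0, Finset.mem_range.2 hNpos⟩
      fun k _ => (hx k).strictAnti τ hij
  have hN0 : (N : ℤ) ≠ 0 := by exact_mod_cast hNpos.ne'
  have hmod : ∀ τ i, (N : ℤ) ∣ y τ i - y 0 ⟨0, hn⟩ := by
    intro τ i
    apply Int.ModEq.dvd
    refine eq_of_invariant hmn hsum hN0 hy (g := fun τ i => y τ i % N) (fun τ i => ?_) _ _ _ _
    rw [hy, Int.add_mul_emod_self_left]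
  choose z hz using hmod
  refine ⟨s, z, fun τ i j hij => ?_, fun τ i => ?_⟩
  · have := hyanti τ hij
    have h1 := hz τ i
    have h2 := hz τ j
    have h3 : (0 : ℤ) < N := by exact_mod_cast hNpos
    nlinarith
  · have h1 := hz (τ - 1) (s τ i)
    have h2 := hz τ i
    have h3 := hy τ i
    apply mul_left_cancel₀ hN0
    simp only [increment]
    linarith

end Existence

section Charts

variable {d n m : ℕ} {mfun : ZMod d → ℤ} {A : Set (ZMod d × ℤ)}

theorem IsChart.add_mul_mem (hA : IsChart d n mfun A) {τ : ZMod d} {x : ℤ} (hx : (τ, x) ∈ A)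
    (k : ℕ) : (τ, x + k * n) ∈ A := by
  induction k with
  | zero => simpa using hx
  | succ k ih =>
    have := hA.2.2.2 _ ih
    simp only at this
    convert this using 2
    push_cast
    ring

theorem IsChart.mem_of_le (hn : 0 < n) (hA : IsChart d n mfun A) {τ : ZMod d} {x y : ℤ}
    (hx : (τ, x) ∈ A) (hxy : x ≤ y) (h : (n : ℤ) ∣ y - x) : (τ, y) ∈ A := by
  obtain ⟨c, hc⟩ := h
  have hn' : (0 : ℤ) < n := by exact_mod_cast hn
  have hc0 : 0 ≤ c := by
    by_contra hlt
    nlinarith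
  lift c to ℕ using hc0
  have := hA.add_mul_mem hx c
  rwa [show x + c * n = y by linarith] at this

/-- An element of `B` is the smallest element of `A` in its residue class. -/
theorem IsChart.le_of_mem_Bset (hn : 0 < n) (hA : IsChart d n mfun A) {τ : ZMod d} {x y : ℤ}
    (hx : (τ, x) ∈ Bset d n A) (hy : (τ, y) ∈ A) (h : (n : ℤ) ∣ x - y) : x ≤ y := by
  by_contra! hlt
  have h1 := Int.le_of_dvd (by linarith) h
  refine hx.2 (hA.mem_of_le hn hy (by simp only; linarith) ?_)
  have : x - n - y = x - y - n := by ring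
  simp only [this]
  exact dvd_sub h dvd_rfl

theorem IsChart.eq_of_mem_Bset (hn : 0 < n) (hA : IsChart d n mfun A) {τ : ZMod d} {x y : ℤ}
    (hx : (τ, x) ∈ Bset d n A) (hy : (τ, y) ∈ Bset d n A) (h : (n : ℤ) ∣ x - y) : x = y :=
  le_antisymm (hA.le_of_mem_Bset hn hx hy.1 h)
    (hA.le_of_mem_Bset hn hy hx.1 ((dvd_sub_comm).1 h))

theorem IsChart.exists_mem_Bset_le (hn : 0 < n) (hA : IsChart d n mfun A) {τ : ZMod d} {x : ℤ}
    (hx : (τ, x) ∈ A) : ∃ y ≤ x, (τ, y) ∈ Bset d n A ∧ (n : ℤ) ∣ x - y := by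
  obtain ⟨c, hc⟩ := hA.2.1
  obtain ⟨y, ⟨hy, hdvd⟩, hmin⟩ := Int.exists_least_of_bdd
    (P := fun y => (τ, y) ∈ A ∧ (n : ℤ) ∣ x - y) ⟨c, fun z hz => hc _ hz.1⟩ ⟨x, hx, by simp⟩
  refine ⟨y, hmin x ⟨hx, by simp⟩, ⟨hy, fun h => ?_⟩, hdvd⟩
  have h1 := hmin (y - n) ⟨h, by rw [sub_sub_eq_add_sub, add_sub_right_comm]; exact dvd_add hdvd dvd_rfl⟩
  have hn' : (0 : ℤ) < n := by exact_mod_cast hn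
  linarith

theorem IsChart.iterate_mem (hA : IsChart d n mfun A) {τ : ZMod d} {x : ℤ} (hx : (τ, x) ∈ A)
    (t : ℕ) : (τ + t, x + ∑ j ∈ Finset.range t, mfun (τ + j)) ∈ A := by
  induction t with
  | zero => simpa using hx
  | succ t ih =>
    have := hA.2.2.1 _ ih
    rwa [Finset.sum_range_succ, Nat.cast_succ, ← add_assoc, ← add_assoc]

variable [NeZero d]

theorem IsChart.add_mul_m_mem (hsum : ∑ τ : ZMod d, mfun τ = (m : ℤ)) (hA : IsChart d n mfun A)
    {τ : ZMod d} {x : ℤ} (hx : (τ, x) ∈ A) (l : ℕ) : (τ, x + l * m) ∈ A := by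
  have h := hA.iterate_mem hx (d * l)
  rw [← sum_range_mul_mfun hsum τ l, ← Finset.sum_range_reflect]
  convert h using 2
  · simp
  · congr 1
    refine Finset.sum_congr rfl fun j hj => ?_
    have h1 : d * l - 1 - j + 1 + j = d * l := by
      have := Finset.mem_range.1 hj
      omega
    have h2 := congrArg (Nat.cast (R := ZMod d)) h1
    push_cast at h2
    rw [CharP.cast_eq_zero (ZMod d) d, zero_mul] at h2
    congr 1
    linear_combination - h2

theorem IsChart.exists_mem_Bset (hn : 0 < n) (hmn : Nat.Coprime m n)
    (hsum : ∑ τ : ZMod d, mfun τ = (m : ℤ)) (hA : IsChart d n mfun A) (τ : ZMod d) (r : ℤ) :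
    ∃ x, (τ, x) ∈ Bset d n A ∧ (n : ℤ) ∣ x - r := by
  have : NeZero n := ⟨hn.ne'⟩
  obtain ⟨⟨τ₀, x₀⟩, h₀⟩ := hA.1
  have h1 := hA.iterate_mem h₀ (τ - τ₀).val
  rw [ZMod.natCast_zmod_val, add_sub_cancel] at h1
  set x₁ := x₀ + ∑ j ∈ Finset.range (τ - τ₀).val, mfun (τ₀ + j)
  let l : ℕ := (((r - x₁ : ℤ) : ZMod n) * (m : ZMod n)⁻¹).val
  obtain ⟨y, -, hy, hdvd⟩ := hA.exists_mem_Bset_le hn (hA.add_mul_m_mem hsum h1 l)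
  refine ⟨y, hy, ?_⟩
  have h2 : (n : ℤ) ∣ x₁ + l * m - r := by
    rw [← ZMod.intCast_zmod_eq_zero_iff_dvd]
    push_cast
    simp only [l, ZMod.natCast_val, ZMod.cast_id', id]
    rw [mul_assoc, mul_comm (m : ZMod n)⁻¹, ZMod.coe_mul_inv_eq_one m hmn]
    push_cast
    ring
  have h3 : y - r = x₁ + l * m - r - (x₁ + l * m - y) := by ring
  rw [h3]
  exact dvd_sub h2 hdvd

/-- `e τ` lists the elements of `B_(τ)` in decreasing order. -/
structure IsEnum (A : Set (ZMod d × ℤ)) (e : ZMod d → Fin n → ℤ) : Prop where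
  strictAnti : ∀ τ, StrictAnti (e τ)
  mem_iff : ∀ τ x, (τ, x) ∈ Bset d n A ↔ ∃ i, e τ i = x

theorem IsChart.exists_isEnum (hn : 0 < n) (hmn : Nat.Coprime m n)
    (hsum : ∑ τ : ZMod d, mfun τ = (m : ℤ)) (hA : IsChart d n mfun A) :
    ∃ e : ZMod d → Fin n → ℤ, IsEnum A e := by
  have hex := fun (τ : ZMod d) (i : Fin n) => hA.exists_mem_Bset hn hmn hsum τ i.val
  choose u hu hdvd using hex
  have hinj : ∀ τ, Function.Injective (u τ) := by
    intro τ i j hij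
    have h1 := dvd_sub (hdvd τ j) (hij ▸ hdvd τ i)
    have := Int.eq_zero_of_abs_lt_dvd h1 (by rw [abs_lt]; omega)
    exact Fin.ext (by omega)
  refine ⟨fun τ => u τ ∘ Tuple.sort (fun i => - u τ i), fun τ => ?_, fun τ x => ⟨fun hx => ?_, ?_⟩⟩
  · refine Antitone.strictAnti_of_injective (fun i j hij => ?_)
      ((hinj τ).comp (Equiv.injective _))
    have := Tuple.monotone_sort (fun i => - u τ i) hij
    simpa using this
  · have hn' : (0 : ℤ) < n := by exact_mod_cast hn
    let i : Fin n := ⟨(x % n).toNat, by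
      have := Int.emod_lt_of_pos x hn'
      have := Int.emod_nonneg x hn'.ne'
      omega⟩
    refine ⟨(Tuple.sort (fun i => - u τ i)).symm i, ?_⟩
    simp only [Function.comp_apply, Equiv.apply_symm_apply]
    refine hA.eq_of_mem_Bset hn (hu τ i) hx ?_
    have h1 : ((i.val : ℕ) : ℤ) = x % n := Int.toNat_of_nonneg (Int.emod_nonneg x hn'.ne')
    have h2 := hdvd τ i
    rw [h1] at h2
    have h3 := dvd_sub h2 (Int.dvd_self_sub_emod (x := x) (m := n))
    rwa [sub_sub_sub_cancel_right] at h3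
  · rintro ⟨i, rfl⟩
    exact hu τ _

/-- The type entry attached to the `i`-th largest element of `B_(τ)`, for `τ ∈ ℤ/d`. -/
noncomputable def cotypeFun (d n : ℕ) (mfun : ZMod d → ℤ) (A : Set (ZMod d × ℤ)) :
    ZMod d → Fin n → ℤ :=
  fun τ i => muOf d n mfun A (τ, btilde d n A τ (i.val + 1))

omit [NeZero d] in
theorem IsEnum.btilde_eq {e : ZMod d → Fin n → ℤ} (he : IsEnum A e) (τ : ZMod d) (i : Fin n) :
    btilde d n A τ (i.val + 1) = e τ i := by
  have hcard : ∀ j, Set.ncard {z : ℤ | (τ, z) ∈ Bset d n A ∧ e τ j < z} = j.val := by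
    intro j
    have : {z : ℤ | (τ, z) ∈ Bset d n A ∧ e τ j < z} = e τ '' Set.Iio j := by
      ext z
      simp only [he.mem_iff, Set.mem_ofPred_eq, Set.mem_image, Set.mem_Iio]
      constructor
      · rintro ⟨⟨k, rfl⟩, hk⟩
        exact ⟨k, (he.strictAnti τ).lt_iff_gt.1 hk, rfl⟩
      · rintro ⟨k, hk, rfl⟩
        exact ⟨⟨k, rfl⟩, he.strictAnti τ hk⟩
    rw [this, Set.ncard_image_of_injective _ (he.strictAnti τ).injective,
      ← Finset.coe_Iio, Set.ncard_coe_finset, Fin.card_Iio]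
  have : {y : ℤ | (τ, y) ∈ Bset d n A ∧
      Set.ncard {z : ℤ | (τ, z) ∈ Bset d n A ∧ y < z} = i.val + 1 - 1} = {e τ i} := by
    ext y
    simp only [Set.mem_ofPred_eq, Set.mem_singleton_iff, Nat.add_sub_cancel]
    constructor
    · rintro ⟨hy, hc⟩
      obtain ⟨j, rfl⟩ := (he.mem_iff τ y).1 hy
      rw [hcard] at hc
      rw [Fin.ext hc]
    · rintro rfl
      exact ⟨(he.mem_iff _ _).2 ⟨i, rfl⟩, hcard i⟩
  rw [btilde, this, csInf_singleton]

theorem eq_of_increment_dvd (hmn : Nat.Coprime m n) (hsum : ∑ τ : ZMod d, mfun τ = (m : ℤ))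
    {e ν : ZMod d → Fin n → ℤ} {s : ZMod d → Equiv.Perm (Fin n)}
    (hs : IsSortStep (increment mfun ν) s e e) : IsIncongruent e :=
  fun _ _ _ h => eq_of_dvd_sub hmn hsum hs.apply_eq h

theorem IsEnum.cotypeFun_eq (hn : 0 < n) (hmn : Nat.Coprime m n)
    (hsum : ∑ τ : ZMod d, mfun τ = (m : ℤ)) {e ν : ZMod d → Fin n → ℤ} (he : IsEnum A e)
    (hν : ∀ τ i, 0 ≤ ν τ i) {s : ZMod d → Equiv.Perm (Fin n)}
    (hs : IsSortStep (increment mfun ν) s e e) : cotypeFun d n mfun A = ν := by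
  have hn' : (0 : ℤ) < n := by exact_mod_cast hn
  funext τ i
  have hstep : e (τ - 1) (s τ i) + mfun (τ - 1) - e τ i = n * ν τ i := by
    rw [hs.apply_eq, increment]
    ring
  have : {y : ℤ | ((τ - 1 : ZMod d), y) ∈ Bset d n A ∧
      (y + mfun (τ - 1) - e τ i) % (n : ℤ) = 0 ∧ e τ i ≤ y + mfun (τ - 1)} =
        {e (τ - 1) (s τ i)} := by
    ext y
    simp only [Set.mem_ofPred_eq, Set.mem_singleton_iff]
    constructor
    · rintro ⟨hy, hmod, -⟩
      obtain ⟨j, rfl⟩ := (he.mem_iff _ y).1 hy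
      have h1 := dvd_sub (Int.dvd_of_emod_eq_zero hmod) (Dvd.intro _ hstep.symm)
      rw [sub_sub_sub_cancel_right, add_sub_add_right_eq_sub] at h1
      rw [eq_of_increment_dvd hmn hsum hs _ _ _ h1]
    · rintro rfl
      refine ⟨(he.mem_iff _ _).2 ⟨_, rfl⟩, ?_, ?_⟩
      · rw [hstep, Int.mul_emod_right]
      · have := mul_nonneg hn'.le (hν τ i)
        linarith
  rw [cotypeFun, he.btilde_eq, muOf]
  simp only
  rw [this, csInf_singleton, hstep, Int.mul_ediv_cancel_left _ hn'.ne']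

/-- The elements of `B` form a fixed family of the sorting dynamics attached to the cotype. -/
theorem IsChart.exists_isSortStep (hn : 0 < n) (hmn : Nat.Coprime m n)
    (hsum : ∑ τ : ZMod d, mfun τ = (m : ℤ)) (hA : IsChart d n mfun A) :
    ∃ e s, IsEnum A e ∧ IsSortStep (increment mfun (cotypeFun d n mfun A)) s e e ∧
      ∀ τ i, 0 ≤ cotypeFun d n mfun A τ i := by
  have hn' : (0 : ℤ) < n := by exact_mod_cast hn
  obtain ⟨e, he⟩ := hA.exists_isEnum hn hmn hsum
  have hmem : ∀ τ i, (τ, e τ i) ∈ Bset d n A := fun τ i => (he.mem_iff _ _).2 ⟨i, rfl⟩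
  have hex : ∀ (τ : ZMod d) (i : Fin n),
      ∃ j c, 0 ≤ c ∧ e (τ - 1) j + mfun (τ - 1) = e τ i + n * c := by
    intro τ i
    obtain ⟨x, hx, hdvd⟩ := hA.exists_mem_Bset hn hmn hsum (τ - 1) (e τ i - mfun (τ - 1))
    obtain ⟨j, rfl⟩ := (he.mem_iff _ _).1 hx
    obtain ⟨c, hc⟩ := hdvd
    have hc' : e (τ - 1) j + mfun (τ - 1) = e τ i + n * c := by linarith
    have h1 := hA.2.2.1 _ hx.1
    simp only [sub_add_cancel] at h1
    have h2 := hA.le_of_mem_Bset hn (hmem τ i) h1 ⟨-c, by rw [hc']; ring⟩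
    refine ⟨j, c, ?_, hc'⟩
    by_contra hlt
    nlinarith
  choose s ν hν hs using hex
  have hinj : ∀ τ, Function.Injective (s τ) := by
    intro τ i j hij
    have h1 := hs τ i
    have h2 := hs τ j
    rw [hij, h2] at h1
    exact (he.strictAnti τ).injective (hA.eq_of_mem_Bset hn (hmem τ i) (hmem τ j)
      ⟨ν τ j - ν τ i, by linarith⟩)
  have hstep : IsSortStep (increment mfun ν)
      (fun τ => Equiv.ofBijective (s τ) (Finite.injective_iff_bijective.1 (hinj τ))) e e :=
    ⟨he.strictAnti, fun τ i => by
      have := hs τ i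
      simp only [Equiv.ofBijective_apply, increment]
      linarith⟩
  have hcot := he.cotypeFun_eq hn hmn hsum hν hstep
  exact ⟨e, _, he, hcot ▸ hstep, hcot ▸ hν⟩

omit [NeZero d] in
theorem IsEnum.mem_chart_iff (hn : 0 < n) (hA : IsChart d n mfun A) {e : ZMod d → Fin n → ℤ}
    (he : IsEnum A e) (p : ZMod d × ℤ) : p ∈ A ↔ ∃ (i : Fin n) (k : ℕ), p.2 = e p.1 i + k * n := by
  obtain ⟨τ, x⟩ := p
  constructor
  · intro hx
    obtain ⟨y, hyx, hy, c, hc⟩ := hA.exists_mem_Bset_le hn hx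
    obtain ⟨i, rfl⟩ := (he.mem_iff _ _).1 hy
    have hn' : (0 : ℤ) < n := by exact_mod_cast hn
    have hc0 : 0 ≤ c := by
      by_contra hlt
      nlinarith
    lift c to ℕ using hc0
    exact ⟨i, c, by simp only; linarith⟩
  · rintro ⟨i, k, hx⟩
    simp only at hx
    rw [hx]
    exact hA.add_mul_mem ((he.mem_iff _ _).2 ⟨i, rfl⟩).1 k

omit [NeZero d] in
theorem IsEnum.isNormalised_iff {e : ZMod d → Fin n → ℤ} (he : IsEnum A e) :
    IsNormalised d n A ↔ ∑ i, e 0 i = ((n * (n - 1) / 2 : ℕ) : ℤ) := by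
  have : {x : ℤ | ((0 : ZMod d), x) ∈ Bset d n A} = Set.range (e 0) := by
    ext x
    exact he.mem_iff 0 x
  rw [IsNormalised, this, finsum_mem_range (he.strictAnti 0).injective, finsum_eq_sum_of_fintype]

/-- A normalised chart is determined by its cotype. -/
theorem IsChart.eq_of_cotypeFun_eq (hn : 0 < n) (hmn : Nat.Coprime m n)
    (hsum : ∑ τ : ZMod d, mfun τ = (m : ℤ)) {A' : Set (ZMod d × ℤ)} (hA : IsChart d n mfun A)
    (hA' : IsChart d n mfun A') (hN : IsNormalised d n A) (hN' : IsNormalised d n A')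
    (h : cotypeFun d n mfun A = cotypeFun d n mfun A') : A = A' := by
  obtain ⟨e, s, he, hs, -⟩ := hA.exists_isSortStep hn hmn hsum
  obtain ⟨e', s', he', hs', -⟩ := hA'.exists_isSortStep hn hmn hsum
  rw [← h] at hs'
  obtain rfl := hs.perm_eq hs' le_rfl
  rw [he.isNormalised_iff] at hN
  rw [he'.isNormalised_iff] at hN'
  have hconst : ∀ τ i, e τ i - e' τ i = e 0 ⟨0, hn⟩ - e' 0 ⟨0, hn⟩ := fun τ i =>
    eq_of_invariant (ν := cotypeFun d n mfun A) hmn hsum one_ne_zero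
      (fun τ i => by rw [one_mul]; exact hs.apply_eq τ i) (g := fun τ i => e τ i - e' τ i)
      (fun τ i => by simp only [hs.apply_eq, hs'.apply_eq, add_sub_add_right_eq_sub]) _ _ _ _
  have hzero : e 0 ⟨0, hn⟩ - e' 0 ⟨0, hn⟩ = 0 := by
    have h1 : ∑ i, (e 0 i - e' 0 i) = 0 := by rw [Finset.sum_sub_distrib, hN, hN', sub_self]
    rw [Finset.sum_congr rfl fun i _ => hconst 0 i] at h1
    rw [Finset.sum_const, Finset.card_univ, Fintype.card_fin, nsmul_eq_mul, mul_eq_zero] at h1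
    exact h1.resolve_left (by exact_mod_cast hn.ne')
  have hee : e = e' := by
    funext τ i
    have := hconst τ i
    linarith
  subst hee
  ext p
  rw [he.mem_chart_iff hn hA, he'.mem_chart_iff hn hA']

end Charts

section Realisation

variable {d n m : ℕ} {mfun : ZMod d → ℤ}

/-- The subset of `ℤ^(d)` generated by a family of elements under translation by `n`. -/
def chartOf (z : ZMod d → Fin n → ℤ) : Set (ZMod d × ℤ) :=
  {p | ∃ (i : Fin n) (k : ℕ), p.2 = z p.1 i + k * n}

theorem isEnum_chartOf (hn : 0 < n) {z : ZMod d → Fin n → ℤ} (hanti : ∀ τ, StrictAnti (z τ))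
    (hz : IsIncongruent z) : IsEnum (chartOf z) z := by
  have hn' : (0 : ℤ) < n := by exact_mod_cast hn
  refine ⟨hanti, fun τ x => ⟨?_, ?_⟩⟩
  · rintro ⟨⟨i, k, hx⟩, hnot⟩
    refine ⟨i, ?_⟩
    simp only at hx
    rcases k with - | k
    · simp [hx]
    · refine absurd ⟨i, k, ?_⟩ hnot
      simp only [hx]
      push_cast
      ring
  · rintro ⟨i, rfl⟩
    refine ⟨⟨i, 0, by simp⟩, ?_⟩
    rintro ⟨j, k, h⟩
    simp only at h
    obtain rfl := hz τ i j ⟨k + 1, by linarith⟩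
    nlinarith [Int.natCast_nonneg k]

theorem isChart_chartOf (hn : 0 < n) [NeZero d] {z ν : ZMod d → Fin n → ℤ} (hν : ∀ τ i, 0 ≤ ν τ i)
    {s : ZMod d → Equiv.Perm (Fin n)} (hs : IsSortStep (increment mfun ν) s z z) :
    IsChart d n mfun (chartOf z) := by
  refine ⟨⟨(0, z 0 ⟨0, hn⟩), ⟨0, hn⟩, 0, by simp⟩, ?_, ?_, ?_⟩
  · obtain ⟨c, hc⟩ := (Set.finite_range (Function.uncurry z)).bddBelow
    refine ⟨c, ?_⟩
    rintro ⟨τ, x⟩ ⟨i, k, hx⟩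
    simp only at hx ⊢
    have := hc ⟨(τ, i), rfl⟩
    simp only [Function.uncurry_apply_pair] at this
    have : (0 : ℤ) ≤ k * n := by positivity
    linarith
  · rintro ⟨τ, x⟩ ⟨i, k, hx⟩
    simp only at hx
    have h1 := hs.apply_eq (τ + 1) ((s (τ + 1)).symm i)
    simp only [increment, add_sub_cancel_right, Equiv.apply_symm_apply] at h1
    refine ⟨(s (τ + 1)).symm i, k + (ν (τ + 1) ((s (τ + 1)).symm i)).toNat, ?_⟩
    push_cast
    rw [Int.toNat_of_nonneg (hν _ _)]
    linear_combination hx + h1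
  · rintro ⟨τ, x⟩ ⟨i, k, hx⟩
    refine ⟨i, k + 1, ?_⟩
    simp only at hx ⊢
    rw [hx]
    push_cast
    ring

theorem dvd_sum_sub_of_incongruent (hn : 0 < n) {z : Fin n → ℤ}
    (hz : ∀ i j, (n : ℤ) ∣ z i - z j → i = j) :
    (n : ℤ) ∣ ∑ i, z i - ((n * (n - 1) / 2 : ℕ) : ℤ) := by
  have : NeZero n := ⟨hn.ne'⟩
  have hz' : Function.Injective fun i => (z i : ZMod n) := by
    intro i j hij
    apply hz
    rw [← ZMod.intCast_zmod_eq_zero_iff_dvd]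
    simpa [sub_eq_zero] using hij
  have hid : Function.Injective fun i : Fin n => ((i.val : ℕ) : ZMod n) := by
    intro i j hij
    have h : ((i.val : ℕ) : ZMod n) = (j.val : ℕ) := hij
    rw [ZMod.natCast_eq_natCast_iff', Nat.mod_eq_of_lt i.2, Nat.mod_eq_of_lt j.2] at h
    exact Fin.ext h
  have hbij : ∀ {g : Fin n → ZMod n}, Function.Injective g → ∑ i, g i = ∑ a, a := fun hg =>
    Fintype.sum_bijective _ ((Fintype.bijective_iff_injective_and_card _).2
      ⟨hg, by simp [ZMod.card]⟩) _ _ fun _ => rfl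
  rw [← Finset.sum_range_id, Finset.sum_range, ← ZMod.intCast_zmod_eq_zero_iff_dvd]
  push_cast
  rw [hbij hz', hbij hid, sub_self]

/-- Every tuple in `P_{m,n,d}` is the cotype of a normalised chart. -/
theorem exists_chart_of_cotypeFun [NeZero d] (hn : 0 < n) (hmn : Nat.Coprime m n)
    (hsum : ∑ τ : ZMod d, mfun τ = (m : ℤ)) {ν : ZMod d → Fin n → ℤ} (hν : ∀ τ i, 0 ≤ ν τ i)
    (hP : ∀ k ≤ n, n * ∑ τ : ZMod d, ∑ i : Fin n, (if i.val < k then ν τ i else 0) ≤ k * (m : ℤ))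
    (htot : ∑ τ : ZMod d, ∑ i : Fin n, ν τ i = m) :
    ∃ A, IsChart d n mfun A ∧ IsNormalised d n A ∧ cotypeFun d n mfun A = ν := by
  obtain ⟨s, z, hz⟩ := exists_fixed hn hmn hsum hP htot
  obtain ⟨c, hc⟩ := dvd_sum_sub_of_incongruent hn (eq_of_increment_dvd hmn hsum hz 0)
  have hw : IsSortStep (increment mfun ν) s (fun τ i => z τ i - c) (fun τ i => z τ i - c) :=
    ⟨fun τ i j hij => sub_lt_sub_right (hz.strictAnti τ hij) c, fun τ i => by
      rw [hz.apply_eq]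
      ring⟩
  have he := isEnum_chartOf hn hw.strictAnti (eq_of_increment_dvd hmn hsum hw)
  refine ⟨_, isChart_chartOf hn hν hw, ?_, he.cotypeFun_eq hn hmn hsum hν hw⟩
  rw [he.isNormalised_iff, Finset.sum_sub_distrib]
  simp only [Finset.sum_const, Finset.card_univ, Fintype.card_fin, nsmul_eq_mul]
  linarith

theorem sum_lt_comp_perm_le {a : Fin n → ℤ} (ha : Antitone a) (s : Equiv.Perm (Fin n)) (k : ℕ) :
    ∑ i : Fin n, (if i.val < k then a (s i) else 0) ≤ ∑ i : Fin n, (if i.val < k then a i else 0) := by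
  have hw : Antitone fun i : Fin n => if i.val < k then (1 : ℤ) else 0 := by
    intro i j hij
    have : i.val ≤ j.val := hij
    beta_reduce
    split_ifs <;> omega
  simpa using (hw.monovary ha).sum_mul_comp_perm_le_sum_mul (σ := s)

/-- The cotype of a chart satisfies the inequalities defining `P_{m,n,d}`. -/
theorem IsChart.sum_cotypeFun_le [NeZero d] (hn : 0 < n) (hmn : Nat.Coprime m n)
    (hsum : ∑ τ : ZMod d, mfun τ = (m : ℤ)) {A : Set (ZMod d × ℤ)} (hA : IsChart d n mfun A) {k : ℕ}
    (hk : k ≤ n) :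
    n * ∑ τ : ZMod d, ∑ i : Fin n, (if i.val < k then cotypeFun d n mfun A τ i else 0)
      ≤ k * (m : ℤ) := by
  obtain ⟨e, s, -, hs, -⟩ := hA.exists_isSortStep hn hmn hsum
  have h1 : ∀ τ : ZMod d, ∑ i : Fin n, (if i.val < k then 1 else 0) *
      increment mfun (cotypeFun d n mfun A) τ i =
        ∑ i : Fin n, (if i.val < k then e (τ - 1) (s τ i) else 0)
          - ∑ i : Fin n, (if i.val < k then e τ i else 0) := by
    intro τ
    rw [← Finset.sum_sub_distrib]
    refine Finset.sum_congr rfl fun i _ => ?_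
    by_cases h : i.val < k <;> simp [h, hs.apply_eq]
  have h2 := sum_increment hsum (cotypeFun d n mfun A) hk
  rw [Fintype.sum_prod_type] at h2
  simp only [Function.uncurry_apply_pair, h1, Finset.sum_sub_distrib] at h2
  have h3 : ∑ τ : ZMod d, ∑ i : Fin n, (if i.val < k then e (τ - 1) (s τ i) else 0) ≤
      ∑ τ : ZMod d, ∑ i : Fin n, (if i.val < k then e τ i else 0) := by
    rw [← sum_pred fun τ => ∑ i : Fin n, (if i.val < k then e τ i else 0)]
    exact Finset.sum_le_sum fun τ _ => sum_lt_comp_perm_le (hs.strictAnti _).antitone _ _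
  linarith

theorem IsChart.sum_cotypeFun_eq [NeZero d] (hn : 0 < n) (hmn : Nat.Coprime m n)
    (hsum : ∑ τ : ZMod d, mfun τ = (m : ℤ)) {A : Set (ZMod d × ℤ)} (hA : IsChart d n mfun A) :
    ∑ τ : ZMod d, ∑ i : Fin n, cotypeFun d n mfun A τ i = m := by
  obtain ⟨e, s, -, hs, -⟩ := hA.exists_isSortStep hn hmn hsum
  have h1 : ∑ τ : ZMod d, ∑ i : Fin n, increment mfun (cotypeFun d n mfun A) τ i = 0 := by
    have h2 : ∑ τ : ZMod d, ∑ i, e (τ - 1) (s τ i) = ∑ τ : ZMod d, ∑ i, e τ i := by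
      simp_rw [fun τ => Equiv.sum_comp (s τ) (e (τ - 1))]
      exact sum_pred fun τ => ∑ i, e τ i
    simp only [hs.apply_eq, Finset.sum_add_distrib] at h2
    linarith
  have h2 := sum_increment hsum (cotypeFun d n mfun A) le_rfl
  simp only [Fin.is_lt, if_true, one_mul] at h2
  rw [Fintype.sum_prod_type] at h2
  simp only [Function.uncurry_apply_pair] at h2
  rw [h1, eq_comm, ← mul_sub, mul_eq_zero, sub_eq_zero] at h2
  exact h2.resolve_left (by exact_mod_cast hn.ne')

end Realisation

section TypeTuple

variable {d n m : ℕ} [NeZero d] {mfun : ZMod d → ℤ} {A : Set (ZMod d × ℤ)}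

/-- The sequence `b 0, b 1, …` follows the inverse of the step permutation. -/
theorem exists_bseq_eq (hn : 0 < n) (hmn : Nat.Coprime m n)
    (hsum : ∑ τ : ZMod d, mfun τ = (m : ℤ)) {e ν : ZMod d → Fin n → ℤ} (he : IsEnum A e)
    (hν : ∀ τ i, 0 ≤ ν τ i) {s : ZMod d → Equiv.Perm (Fin n)}
    (hs : IsSortStep (increment mfun ν) s e e) :
    ∃ q : ℕ → ZMod d × Fin n, (∀ k, (q k).1 = k) ∧ (∀ k, stepPerm s (q (k + 1)) = q k) ∧
      ∀ k, typeInt d n mfun A (k + 1) = Function.uncurry ν (q (k + 1)) := by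
  have hn' : (0 : ℤ) < n := by exact_mod_cast hn
  have hB : {x : ℤ | ((0 : ZMod d), x) ∈ Bset d n A} = Set.range (e 0) := by
    ext x
    exact he.mem_iff 0 x
  obtain ⟨i₀, hi₀⟩ : ∃ i, e 0 i = sInf {x : ℤ | ((0 : ZMod d), x) ∈ Bset d n A} := by
    rw [hB]
    have hne : (Set.range (e 0)).Nonempty := ⟨_, ⟨0, hn⟩, rfl⟩
    exact hne.csInf_mem (Set.finite_range _)
  let q : ℕ → ZMod d × Fin n := fun k => (stepPerm s).symm^[k] (0, i₀)
  have hq : ∀ k, stepPerm s (q (k + 1)) = q k := fun k => by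
    simp only [q, Function.iterate_succ_apply', Equiv.apply_symm_apply]
  have hfst : ∀ k, (q (k + 1)).1 = (q k).1 + 1 := fun k => by
    rw [← hq k]
    simp [stepPerm]
  have hval : ∀ k, e (q k).1 (q k).2 + mfun (q k).1 - e (q (k + 1)).1 (q (k + 1)).2 =
      n * Function.uncurry ν (q (k + 1)) := by
    intro k
    have h1 := hs.apply_eq (q (k + 1)).1 (q (k + 1)).2
    rw [← hq k]
    simp only [stepPerm, Equiv.coe_fn_mk]
    rw [h1, increment, Function.uncurry]
    ring
  have hb : ∀ k, bseq d n mfun A k = ((q k).1, e (q k).1 (q k).2) := by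
    intro k
    induction k with
    | zero => rw [bseq, ← hi₀]; rfl
    | succ k ih =>
      have : {y : ℤ | ((q k).1 + 1, y) ∈ Bset d n A ∧
          (e (q k).1 (q k).2 + mfun (q k).1 - y) % (n : ℤ) = 0 ∧
          y ≤ e (q k).1 (q k).2 + mfun (q k).1} = {e (q (k + 1)).1 (q (k + 1)).2} := by
        rw [← hfst]
        ext y
        simp only [Set.mem_ofPred_eq, Set.mem_singleton_iff]
        constructor
        · rintro ⟨hy, hmod, -⟩
          obtain ⟨j, rfl⟩ := (he.mem_iff _ y).1 hy
          have h1 := dvd_sub (Int.dvd_of_emod_eq_zero hmod) (Dvd.intro _ (hval k).symm)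
          rw [sub_sub_sub_cancel_left] at h1
          rw [eq_of_increment_dvd hmn hsum hs _ _ _ h1]
        · rintro rfl
          refine ⟨(he.mem_iff _ _).2 ⟨_, rfl⟩, ?_, ?_⟩
          · rw [hval, Int.mul_emod_right]
          · have h1 := hval k
            have h2 := mul_nonneg hn'.le (hν (q (k + 1)).1 (q (k + 1)).2)
            simp only [Function.uncurry] at h1
            linarith
      rw [bseq, ih]
      simp only
      rw [this, csInf_singleton, hfst]
  refine ⟨q, fun k => ?_, hq, fun k => ?_⟩
  · induction k with
    | zero => simp [q]
    | succ k ih => rw [hfst, ih, Nat.cast_succ]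
  · rw [typeInt, Nat.add_sub_cancel, hb, hb]
    simp only
    rw [hval, Int.mul_ediv_cancel_left _ hn'.ne']

omit [NeZero d] in
theorem domOf_eq_of_perm {μ₁ μ₂ : Fin d → Fin n → ℤ} (π : Fin d → Equiv.Perm (Fin n))
    (h : ∀ τ i, μ₁ τ i = μ₂ τ (π τ i)) : domOf d n μ₁ = domOf d n μ₂ := by
  funext τ i
  have h1 := congrFun (Tuple.comp_perm_comp_sort_eq_comp_sort (f := fun j => -(μ₂ τ j))
    (σ := π τ)) i
  have h2 : (fun j => -(μ₁ τ j)) = (fun j => -(μ₂ τ j)) ∘ π τ := by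
    funext j
    simp [h]
  rw [← h2] at h1
  simpa [domOf] using h1

/-- The type and the cotype of a chart have the same dominant rearrangement. -/
theorem IsChart.domOf_typeTup (hn : 0 < n) (hmn : Nat.Coprime m n)
    (hsum : ∑ τ : ZMod d, mfun τ = (m : ℤ)) (hA : IsChart d n mfun A) :
    domOf d n (typeTup d n mfun A) = domOf d n (cotypeTup d n mfun A) := by
  obtain ⟨e, s, he, hs, hν⟩ := hA.exists_isSortStep hn hmn hsum
  obtain ⟨q, hfst, hq, htype⟩ := exists_bseq_eq hn hmn hsum he hν hs
  have hiter : ∀ a t, (stepPerm s)^[t] (q (a + t)) = q a := by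
    intro a t
    induction t with
    | zero => rfl
    | succ t ih => rw [Function.iterate_succ_apply, ← add_assoc, hq, ih]
  have hs' : ∀ τ i, e (τ - 1) (s τ i) =
      e τ i + 1 * (n * cotypeFun d n mfun A τ i - mfun (τ - 1)) := fun τ i => by
    rw [one_mul]
    exact hs.apply_eq τ i
  have hne : ∀ (τ : Fin d) (i j : Fin n), i < j →
      (q (τ.val + 1 + i.val * d)).2 ≠ (q (τ.val + 1 + j.val * d)).2 := by
    intro τ i j hij heq
    have hlt : i.val < j.val := hij
    obtain ⟨l, hl⟩ := Nat.exists_eq_add_of_lt hlt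
    have hqq : q (τ.val + 1 + i.val * d) = q (τ.val + 1 + j.val * d) := by
      refine Prod.ext ?_ heq
      rw [hfst, hfst]
      simp
    have h1 := hiter (τ.val + 1 + i.val * d) ((l + 1) * d)
    rw [show τ.val + 1 + i.val * d + (l + 1) * d = τ.val + 1 + j.val * d by rw [hl]; ring,
      hqq] at h1
    have h2 := mul_dvd_of_iterate_eq hmn hsum one_ne_zero hs' h1
    rw [mul_comm d n] at h2
    have h3 := Nat.le_of_dvd (Nat.succ_pos l) (Nat.dvd_of_mul_dvd_mul_right (NeZero.pos d) h2)
    have := j.2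
    omega
  have hinj : ∀ τ : Fin d, Function.Injective fun i : Fin n => (q (τ.val + 1 + i.val * d)).2 := by
    intro τ i j hij
    rcases lt_trichotomy i j with h | h | h
    · exact absurd hij (hne τ i j h)
    · exact h
    · exact absurd hij.symm (hne τ j i h)
  refine domOf_eq_of_perm
    (fun τ => Equiv.ofBijective _ (Finite.injective_iff_bijective.1 (hinj τ))) fun τ i => ?_
  have h1 := htype (τ.val + i.val * d)
  rw [show τ.val + i.val * d + 1 = τ.val + 1 + i.val * d by ring] at h1
  have h2 := hfst (τ.val + 1 + i.val * d)
  rw [typeTup, h1, Function.uncurry, h2]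
  simp [cotypeTup, cotypeFun]

end TypeTuple

/-- The identification of the index set `{1, …, d}` with `ℤ/d`. -/
noncomputable def indexEquiv (d : ℕ) [NeZero d] : Fin d ≃ ZMod d :=
  Equiv.ofBijective (fun τ => ((τ.val + 1 : ℕ) : ZMod d)) <| by
    rw [Fintype.bijective_iff_injective_and_card]
    refine ⟨fun a b hab => ?_, by simp [ZMod.card]⟩
    have h : ((a.val : ℕ) : ZMod d) = (b.val : ℕ) := by simpa using hab
    rw [ZMod.natCast_eq_natCast_iff', Nat.mod_eq_of_lt a.2, Nat.mod_eq_of_lt b.2] at h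
    exact Fin.ext h

theorem cotypeTup_eq {d n : ℕ} [NeZero d] (mfun : ZMod d → ℤ) (A : Set (ZMod d × ℤ)) :
    cotypeTup d n mfun A = fun τ => cotypeFun d n mfun A (indexEquiv d τ) :=
  rfl

end ELChart

open ELChart

/-- Fix a dominant tuple `μ ∈ (ℤ_{≥0}ⁿ)^d`.  The Hodge point of an EL-chart
`A` is `(type A)_dom`.  Then `A ↦ cotype A` induces a bijection from the set of normalised
EL-charts with Hodge point `μ` onto `P_μ = { μ' ∈ P_{m,n,d} : μ'_dom = μ }`. -/
theorem cotype_bijection_normalised_Pmu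
    (d n m : ℕ) [NeZero d] (hn : 0 < n) (hm : 0 < m) (hmn : Nat.Coprime m n)
    (mfun : ZMod d → ℤ) (hsum : ∑ τ : ZMod d, mfun τ = (m : ℤ))
    (μ : Fin d → Fin n → ℤ) (hpos : ∀ τ i, 0 ≤ μ τ i) (hdom : IsDom d n μ) :
    (∀ A : Set (ZMod d × ℤ), IsChart d n mfun A → IsNormalised d n A →
      domOf d n (typeTup d n mfun A) = μ →
        memP d n m (cotypeTup d n mfun A) ∧ domOf d n (cotypeTup d n mfun A) = μ) ∧
    (∀ A A' : Set (ZMod d × ℤ),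
      IsChart d n mfun A → IsNormalised d n A → domOf d n (typeTup d n mfun A) = μ →
      IsChart d n mfun A' → IsNormalised d n A' → domOf d n (typeTup d n mfun A') = μ →
      cotypeTup d n mfun A = cotypeTup d n mfun A' → A = A') ∧
    (∀ μ' : Fin d → Fin n → ℤ, memP d n m μ' → domOf d n μ' = μ →
      ∃ A : Set (ZMod d × ℤ), IsChart d n mfun A ∧ IsNormalised d n A ∧
        domOf d n (typeTup d n mfun A) = μ ∧ cotypeTup d n mfun A = μ') := by
  have hfun : ∀ A A' : Set (ZMod d × ℤ), cotypeTup d n mfun A = cotypeTup d n mfun A' →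
      cotypeFun d n mfun A = cotypeFun d n mfun A' := fun A A' h => by
    simp only [cotypeTup_eq] at h
    funext τ
    simpa using congrFun h ((indexEquiv d).symm τ)
  refine ⟨fun A hA _ hμ => ⟨⟨?_, ?_, ?_⟩, hA.domOf_typeTup hn hmn hsum ▸ hμ⟩,
    fun A A' hA hN _ hA' hN' _ h => hA.eq_of_cotypeFun_eq hn hmn hsum hA' hN hN' (hfun A A' h), ?_⟩
  · obtain ⟨_, _, -, -, hν⟩ := hA.exists_isSortStep hn hmn hsum
    exact fun τ i => hν _ _
  · intro k _ hk
    rw [cotypeTup_eq, Equiv.sum_comp (indexEquiv d) (fun τ =>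
      ∑ i : Fin n, if i.val + 1 ≤ k then cotypeFun d n mfun A τ i else 0)]
    exact hA.sum_cotypeFun_le hn hmn hsum hk
  · rw [cotypeTup_eq, Equiv.sum_comp (indexEquiv d) (fun τ => ∑ i, cotypeFun d n mfun A τ i)]
    exact hA.sum_cotypeFun_eq hn hmn hsum
  · rintro μ' ⟨hν, hP, htot⟩ hμ
    have hP' : ∀ k ≤ n, n * ∑ τ : ZMod d, ∑ i : Fin n,
        (if i.val < k then μ' ((indexEquiv d).symm τ) i else 0) ≤ k * (m : ℤ) := by
      intro k hk
      rw [Equiv.sum_comp (indexEquiv d).symm (fun τ => ∑ i : Fin n, if i.val < k then μ' τ i else 0)]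
      rcases k.eq_zero_or_pos with rfl | hk0
      · simp
      · exact hP k hk0 hk
    have htot' : ∑ τ : ZMod d, ∑ i : Fin n, μ' ((indexEquiv d).symm τ) i = m :=
      (Equiv.sum_comp (indexEquiv d).symm (fun τ => ∑ i : Fin n, μ' τ i)).trans htot
    obtain ⟨A, hA, hN, hcot⟩ :=
      exists_chart_of_cotypeFun hn hmn hsum (fun _ _ => hν _ _) hP' htot'
    have hcot' : cotypeTup d n mfun A = μ' := by
      rw [cotypeTup_eq, hcot]
      simp
    refine ⟨A, hA, hN, ?_, hcot'⟩
    rw [hA.domOf_typeTup hn hmn hsum, hcot', hμ]
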